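/- Let ρ < 0 be a real number, m ≥ 1 a natural number, and p : {1,…,m} → ℕ. Define u : ℝᵐ → ℝ (Euclidean space) by u(y) = e^{(ρ/2)‖y‖²} · ∏_{i=1}^{m} He_{p_i}(√(−ρ)·y_i). Then for every y ∈ ℝᵐ, Δu(y) − ρ·⟨y, ∇u(y)⟩ = ρ·(m + ∑_{i=1}^{m} p_i)·u(y). Since ∇f(y) = ρy for f(y) = (ρ/2)‖y‖², this says u is an eigenfunction of the drift Laplacian Δ_f of the Gaussian expander (ℝᵐ, f) with eigenvalue −ρ(m + ∑ p_i) for −Δ_f (the Euclidean-factor eigenfunction claim of Theorem 5.4 of the paper). -/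

import Mathlib

open scoped RealInnerProductSpace
open Polynomial

/-- The Euclidean Laplacian of `u` at `x`: the sum of the pure second derivatives
in the standard coordinate directions. -/
noncomputable def lap {ι : Type*} [Fintype ι] [DecidableEq ι]
    (u : EuclideanSpace ℝ ι → ℝ) (x : EuclideanSpace ℝ ι) : ℝ :=
  ∑ i, fderiv ℝ (fun y => fderiv ℝ u y (EuclideanSpace.single i 1)) x
    (EuclideanSpace.single i 1)

theorem derivative_hermite_succ (n : ℕ) :
    derivative (hermite (n + 1)) = (n + 1 : ℤ[X]) * hermite n := by
  induction n with
  | zero => simp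
  | succ n ih =>
    rw [hermite_succ (n + 1), derivative_sub, derivative_mul, derivative_X, ih, derivative_mul]
    have h : derivative (hermite n) = X * hermite n - hermite (n + 1) := by
      rw [hermite_succ]; ring
    rw [h]
    simp only [derivative_add, derivative_natCast, derivative_one]
    push_cast
    ring

theorem hermite_ode (n : ℕ) :
    derivative (derivative (hermite n)) =
      X * derivative (hermite n) - (n : ℤ[X]) * hermite n := by
  have h := derivative_hermite_succ n
  rw [hermite_succ, derivative_sub, derivative_mul, derivative_X] at h
  linear_combination -h

/-- The one-variable factor `e^{ρt²/2} q(ct)`. -/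
noncomputable def gaussianFactor (ρ c : ℝ) (q : ℤ[X]) (t : ℝ) : ℝ :=
  Real.exp (ρ / 2 * t ^ 2) * aeval (c * t) q

theorem hasDerivAt_gaussianFactor (ρ c : ℝ) (q : ℤ[X]) (t : ℝ) :
    HasDerivAt (gaussianFactor ρ c q)
      (ρ * t * gaussianFactor ρ c q t + c * gaussianFactor ρ c (derivative q) t) t := by
  have h₁ : HasDerivAt (fun t : ℝ => Real.exp (ρ / 2 * t ^ 2))
      (Real.exp (ρ / 2 * t ^ 2) * (ρ * t)) t := by
    convert ((hasDerivAt_pow 2 t).const_mul (ρ / 2)).exp using 1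
    push_cast
    ring
  have h₂ : HasDerivAt (fun t : ℝ => aeval (c * t) q) (aeval (c * t) (derivative q) * c) t := by
    simpa [Function.comp_def] using
      (q.hasDerivAt_aeval (c * t)).comp t ((hasDerivAt_id t).const_mul c)
  refine (h₁.mul h₂).congr_deriv ?_
  unfold gaussianFactor
  ring

theorem deriv_gaussianFactor (ρ c : ℝ) (q : ℤ[X]) :
    deriv (gaussianFactor ρ c q) = fun t =>
      ρ * t * gaussianFactor ρ c q t + c * gaussianFactor ρ c (derivative q) t :=
  funext fun t => (hasDerivAt_gaussianFactor ρ c q t).deriv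

theorem differentiable_gaussianFactor (ρ c : ℝ) (q : ℤ[X]) :
    Differentiable ℝ (gaussianFactor ρ c q) :=
  fun t => (hasDerivAt_gaussianFactor ρ c q t).differentiableAt

theorem differentiable_deriv_gaussianFactor (ρ c : ℝ) (q : ℤ[X]) :
    Differentiable ℝ (deriv (gaussianFactor ρ c q)) := by
  have h₁ := differentiable_gaussianFactor ρ c q
  have h₂ := differentiable_gaussianFactor ρ c (derivative q)
  rw [deriv_gaussianFactor]
  fun_prop

theorem gaussianFactor_hermite_ode {ρ c : ℝ} (hc : c ^ 2 = -ρ) (n : ℕ) (t : ℝ) :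
    deriv (deriv (gaussianFactor ρ c (hermite n))) t
        - ρ * (t * deriv (gaussianFactor ρ c (hermite n)) t) =
      ρ * (1 + n) * gaussianFactor ρ c (hermite n) t := by
  have h := ((((hasDerivAt_id t).const_mul ρ).mul
    (hasDerivAt_gaussianFactor ρ c (hermite n) t)).add
    ((hasDerivAt_gaussianFactor ρ c (derivative (hermite n)) t).const_mul c)).deriv
  rw [deriv_gaussianFactor]
  refine (congrArg (· - _) h).trans ?_
  rw [hermite_ode]
  simp only [gaussianFactor, map_sub, map_mul, aeval_X, map_natCast, id]
  linear_combination (Real.exp (ρ / 2 * t ^ 2) * (c * t * aeval (c * t) (derivative (hermite n))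
    - n * aeval (c * t) (hermite n))) * hc

section ProductFunctions

variable {ι : Type*} [Fintype ι] [DecidableEq ι] {φ : ι → ℝ → ℝ}

theorem prod_update_apply (i : ι) (g : ℝ → ℝ) (y : ι → ℝ) :
    ∏ j, Function.update φ i g j (y j) = g (y i) * ∏ j ∈ Finset.univ.erase i, φ j (y j) := by
  rw [← Finset.mul_prod_erase _ _ (Finset.mem_univ i), Function.update_self]
  congr 1
  exact Finset.prod_congr rfl fun j hj => by
    rw [Function.update_of_ne (Finset.ne_of_mem_erase hj)]

theorem fderiv_prod_coord_single (hφ : ∀ i, Differentiable ℝ (φ i)) (i : ι)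
    (y : EuclideanSpace ℝ ι) :
    fderiv ℝ (fun y : EuclideanSpace ℝ ι => ∏ j, φ j (y j)) y (EuclideanSpace.single i 1) =
      ∏ j, Function.update φ i (deriv (φ i)) j (y j) := by
  have h : ∀ j ∈ Finset.univ, HasFDerivAt (fun y : EuclideanSpace ℝ ι => φ j (y j))
      (deriv (φ j) (y j) • (EuclideanSpace.proj j : EuclideanSpace ℝ ι →L[ℝ] ℝ)) y := fun j _ =>
    (hφ j (y j)).hasDerivAt.comp_hasFDerivAt y
      (EuclideanSpace.proj j : EuclideanSpace ℝ ι →L[ℝ] ℝ).hasFDerivAt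
  rw [(HasFDerivAt.finsetProd h).fderiv, prod_update_apply]
  simp [mul_comm]

theorem lap_prod_coord (hφ : ∀ i, Differentiable ℝ (φ i))
    (hφ' : ∀ i, Differentiable ℝ (deriv (φ i))) (y : EuclideanSpace ℝ ι) :
    lap (fun y : EuclideanSpace ℝ ι => ∏ j, φ j (y j)) y =
      ∑ i, deriv (deriv (φ i)) (y i) * ∏ j ∈ Finset.univ.erase i, φ j (y j) := by
  refine Finset.sum_congr rfl fun i _ => ?_
  have hd : ∀ j, Differentiable ℝ (Function.update φ i (deriv (φ i)) j) := by
    intro j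
    by_cases hj : j = i
    · subst hj
      simpa using hφ' j
    · simpa [hj] using hφ j
  simp_rw [fderiv_prod_coord_single hφ]
  rw [fderiv_prod_coord_single hd, Function.update_self, Function.update_idem,
    prod_update_apply]

theorem inner_gradient_eq_sum (u : EuclideanSpace ℝ ι → ℝ) (y : EuclideanSpace ℝ ι) :
    ⟪y, gradient u y⟫ = ∑ i, y i * fderiv ℝ u y (EuclideanSpace.single i 1) := by
  rw [real_inner_comm, gradient, InnerProductSpace.toDual_symm_apply]
  conv_lhs => rw [← (EuclideanSpace.basisFun ι ℝ).sum_repr y, map_sum]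
  rw [(EuclideanSpace.basisFun ι ℝ).sum_repr y]
  simp

end ProductFunctions

/-- Euclidean-factor eigenfunction claim of Theorem 5.4: for `ρ < 0`, the function
`u(y) = e^{(ρ/2)‖y‖²} ∏ He_{p_i}(√(-ρ) y_i)` satisfies
`Δu - ρ⟨y, ∇u⟩ = ρ(m + ∑ p_i) u` on the Gaussian expander `(ℝᵐ, (ρ/2)‖y‖²)`. -/
theorem gaussian_expander_eigenfunction (ρ : ℝ) (hρ : ρ < 0) (m : ℕ) (hm : 1 ≤ m)
    (p : Fin m → ℕ) (u : EuclideanSpace ℝ (Fin m) → ℝ)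
    (hu : ∀ y : EuclideanSpace ℝ (Fin m), u y =
      Real.exp (ρ / 2 * ‖y‖ ^ 2) *
        ∏ i, aeval (Real.sqrt (-ρ) * y i) (hermite (p i))) :
    ∀ y : EuclideanSpace ℝ (Fin m),
      lap u y - ρ * ⟪y, gradient u y⟫ = ρ * (m + ∑ i, (p i : ℝ)) * u y := by
  intro y
  set φ : Fin m → ℝ → ℝ := fun i => gaussianFactor ρ (Real.sqrt (-ρ)) (hermite (p i)) with hφ
  have hu' : u = fun y : EuclideanSpace ℝ (Fin m) => ∏ i, φ i (y i) := by
    funext y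
    simp only [hu, hφ, gaussianFactor, Finset.prod_mul_distrib, ← Real.exp_sum, ← Finset.mul_sum,
      EuclideanSpace.real_norm_sq_eq]
  have hd : ∀ i, Differentiable ℝ (φ i) := fun i => differentiable_gaussianFactor _ _ _
  have hc : Real.sqrt (-ρ) ^ 2 = -ρ := Real.sq_sqrt (by linarith)
  rw [inner_gradient_eq_sum, hu',
    lap_prod_coord hd fun i => differentiable_deriv_gaussianFactor _ _ _]
  simp_rw [fderiv_prod_coord_single hd, prod_update_apply]
  rw [Finset.mul_sum, ← Finset.sum_sub_distrib]
  have hm' : (m : ℝ) + ∑ i, (p i : ℝ) = ∑ i, (1 + (p i : ℝ)) := by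
    simp [Finset.sum_add_distrib]
  rw [hm', Finset.mul_sum, Finset.sum_mul]
  refine Finset.sum_congr rfl fun i _ => ?_
  rw [← Finset.mul_prod_erase _ _ (Finset.mem_univ i)]
  linear_combination (∏ j ∈ Finset.univ.erase i, φ j (y j)) *
    gaussianFactor_hermite_ode hc (p i) (y i)
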